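/- Let V, Q be finite-dimensional real inner product spaces, B : V → Q linear, a : V×V → ℝ symmetric positive definite, ε > 0, and A_ε(u,v) = a(u,v) + ε⁻¹⟨Bu, Bv⟩. Define the mixed operator 𝒜_ε on V × Q by 𝒜_ε(u,p) applied against test pairs (v,q) as a(u,v) + ⟨p, Bv⟩ − ⟨q, Bu⟩ + ε⟨p,q⟩. Let X_ε = {(u,p) ∈ V × Q : B u = ε p}. Then for (u,p) ∈ X_ε and any subspace pair (V', Q') with B(V') ⊆ Q', the Galerkin (Ritz) projection of (u,p) onto V' × Q' with respect to 𝒜_ε again lies in {(u',p') ∈ V'×Q' : B u' = ε p'}, and its velocity component equals the A_ε-orthogonal projection of u onto V'. -/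

import Mathlib

open RealInnerProductSpace

/-- The Ritz (Galerkin) projection of the mixed nearly incompressible problem
preserves the constraint subspace `X_ε = {(u,p) : Bu = εp}` and its velocity
component is the `A_ε`-orthogonal projection of `u`. -/
theorem mixed_ritz_projection_preserves_constraint
    {V Q : Type*} [NormedAddCommGroup V] [InnerProductSpace ℝ V] [FiniteDimensional ℝ V]
    [NormedAddCommGroup Q] [InnerProductSpace ℝ Q] [FiniteDimensional ℝ Q]
    (B : V →ₗ[ℝ] Q)
    (a : V →ₗ[ℝ] V →ₗ[ℝ] ℝ)
    (hsym : ∀ x y : V, a x y = a y x)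
    (hpos : ∀ x : V, x ≠ 0 → 0 < a x x)
    (ε : ℝ) (hε : 0 < ε)
    (V' : Submodule ℝ V) (Q' : Submodule ℝ Q)
    (hBsub : ∀ v ∈ V', B v ∈ Q')
    (u : V) (p : Q) (hconstraint : B u = ε • p)
    (u' : V) (p' : Q) (hu' : u' ∈ V') (hp' : p' ∈ Q')
    (hritz : ∀ v ∈ V', ∀ q ∈ Q',
      a u' v + ⟪p', B v⟫ - ⟪q, B u'⟫ + ε * ⟪p', q⟫ =
      a u v + ⟪p, B v⟫ - ⟪q, B u⟫ + ε * ⟪p, q⟫) :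
    B u' = ε • p' ∧
    ∀ v ∈ V', a u' v + ε⁻¹ * ⟪B u', B v⟫ = a u v + ε⁻¹ * ⟪B u, B v⟫ := by
  have key : B u' = ε • p' := by
    have hq : B u' - ε • p' ∈ Q' :=
      Q'.sub_mem (hBsub u' hu') (Q'.smul_mem ε hp')
    have h := hritz 0 V'.zero_mem _ hq
    rw [hconstraint] at h
    simp only [map_zero, inner_zero_right, real_inner_smul_right] at h
    rw [real_inner_comm _ p', real_inner_comm _ p] at h
    have h0 : inner ℝ (B u' - ε • p') (B u' - ε • p') = 0 := by
      rw [inner_sub_right (B u' - ε • p') (B u') (ε • p'), real_inner_smul_right]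
      linarith
    exact sub_eq_zero.mp (inner_self_eq_zero.mp h0)
  refine ⟨key, fun v hv => ?_⟩
  have h := hritz v hv 0 Q'.zero_mem
  simp only [inner_zero_left, inner_zero_right] at h
  rw [key, hconstraint, real_inner_smul_left, real_inner_smul_left,
    inv_mul_cancel_left₀ hε.ne', inv_mul_cancel_left₀ hε.ne']
  linarith
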